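/- Let E be a real normed vector space, x ∈ E, k ≥ 1 an integer, and let r : E → ℝ be of class C^k on a neighborhood of x. Then there exist continuous k-multilinear maps T¹, …, T^k from E^k to ℝ, depending only on r and x (not on w), with T¹(v₁, …, v_k) = ∏_{i=1}^{k} Dr(x)(v_i) (the k-fold tensor power of the differential of r at x), such that for every function w : ℝ → ℝ of class C^k on a neighborhood of r(x), the k-th iterated Fréchet derivative of the composition w ∘ r at x satisfies D^k(w∘r)(x) = Σ_{j=0}^{k−1} w^{(k−j)}(r(x)) · T^{j+1}, where w^{(i)} denotes the i-th derivative of w. -/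

import Mathlib

lemma OrderedFinpartition.eq_atomic_of_length {n : ℕ} (c : OrderedFinpartition n)
    (h : c.length = n) : c = OrderedFinpartition.atomic n := by
  have h1 : ∀ i, c.partSize i = 1 := by
    have hs := c.sum_sigma_eq_sum (fun _ => (1 : ℕ))
    simp only [Finset.sum_const, Finset.card_univ, Fintype.card_fin, smul_eq_mul, mul_one] at hs
    have hs' : ∑ m : Fin c.length, 1 = ∑ m : Fin c.length, c.partSize m := by
      rw [hs]; simp [h]
    have := (Finset.sum_eq_sum_iff_of_le (fun i _ => c.partSize_pos i)).1 hs'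
    exact fun i => (this i (Finset.mem_univ i)).symm
  rcases c with ⟨length, partSize, hp, emb, he, hm, hd, hc⟩
  dsimp only at h h1
  subst h
  obtain rfl : partSize = fun _ ↦ 1 := funext h1
  have h2 : ∀ i : Fin length, emb i 0 = i := by
    intro i
    have := Subsingleton.elim (α := Fin length ≃o Fin length)
      (StrictMono.orderIsoOfSurjective (fun m : Fin length => emb m 0) hm
        (Finite.surjective_of_injective hm.injective)) (OrderIso.refl _)
    exact congrArg (fun e : Fin length ≃o Fin length => e i) this
  have h3 : emb = fun m _ => m := by
    funext m a
    rw [Subsingleton.elim a 0]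
    exact h2 m
  subst h3
  rfl

/-- Euclidean version of Lemma 4.8 (higher-order chain rule organized by the order of the
derivative of `w`): there are continuous `k`-multilinear maps `T 0, …, T (k-1)` depending
only on `r` and `x`, with `T 0 = Dr(x) ⊗ ⋯ ⊗ Dr(x)`, such that for every `C^k` function
`w`, `D^k(w ∘ r)(x) = ∑_{j=0}^{k-1} w^{(k-j)}(r(x)) • T j`. -/
theorem iteratedFDeriv_comp_decomposition {E : Type*} [NormedAddCommGroup E]
    [NormedSpace ℝ E] (x : E) (k : ℕ) (hk : 0 < k) (r : E → ℝ)
    (hr : ContDiffAt ℝ k r x) :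
    ∃ T : Fin k → ContinuousMultilinearMap ℝ (fun _ : Fin k => E) ℝ,
      (∀ v : Fin k → E, T ⟨0, hk⟩ v = ∏ i, fderiv ℝ r x (v i)) ∧
      ∀ w : ℝ → ℝ, ContDiffAt ℝ k w (r x) →
        iteratedFDeriv ℝ k (w ∘ r) x
          = ∑ j : Fin k, iteratedDeriv (k - (j : ℕ)) w (r x) • T j := by
  classical
  let S : OrderedFinpartition k → ContinuousMultilinearMap ℝ (fun _ : Fin k => E) ℝ :=
    fun c => c.compAlongOrderedFinpartition
      (ContinuousMultilinearMap.mkPiAlgebra ℝ (Fin c.length) ℝ)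
      (fun m => iteratedFDeriv ℝ (c.partSize m) r x)
  have hS : ∀ c v, S c v = ∏ m, iteratedFDeriv ℝ (c.partSize m) r x (v ∘ c.emb m) := by
    intro c v
    simp only [S, OrderedFinpartition.compAlongOrderFinpartition_apply,
      ContinuousMultilinearMap.mkPiAlgebra_apply]
    rfl
  refine ⟨fun j => ∑ c : OrderedFinpartition k with c.length = k - (j : ℕ), S c, ?_, ?_⟩
  · intro v
    have hf : (Finset.univ.filter fun c : OrderedFinpartition k => c.length = k - 0)
        = {OrderedFinpartition.atomic k} := by
      ext c
      simp only [Finset.mem_filter, Finset.mem_univ, true_and, Finset.mem_singleton, Nat.sub_zero]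
      exact ⟨fun h => c.eq_atomic_of_length h, fun h => by rw [h]; rfl⟩
    change (∑ c : OrderedFinpartition k with c.length = k - 0, S c) v = _
    rw [hf, Finset.sum_singleton, hS]
    change ∏ m : Fin k, iteratedFDeriv ℝ 1 r x (v ∘ fun _ => m) = _
    simp
  · intro w hw
    rw [iteratedFDeriv_comp hw hr le_rfl]
    have hterm : ∀ c : OrderedFinpartition k,
        (ftaylorSeries ℝ w (r x)).compAlongOrderedFinpartition (ftaylorSeries ℝ r x) c
          = iteratedDeriv c.length w (r x) • S c := by
      intro c
      ext v
      rw [FormalMultilinearSeries.compAlongOrderedFinpartition_apply,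
        ContinuousMultilinearMap.smul_apply, hS]
      change iteratedFDeriv ℝ c.length w (r x) _ = _
      rw [iteratedFDeriv_apply_eq_iteratedDeriv_mul_prod, smul_eq_mul, smul_eq_mul, mul_comm]
      rfl
    rw [FormalMultilinearSeries.taylorComp, Finset.sum_congr rfl fun c _ => hterm c]
    let g : OrderedFinpartition k → Fin k := fun c =>
      ⟨k - c.length, by have := c.length_pos hk; omega⟩
    rw [← Finset.sum_fiberwise Finset.univ g]
    refine Finset.sum_congr rfl fun j _ => ?_
    rw [Finset.smul_sum]
    have hfil : (Finset.univ.filter fun c : OrderedFinpartition k => g c = j)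
        = Finset.univ.filter fun c : OrderedFinpartition k => c.length = k - (j : ℕ) := by
      ext c
      simp only [Finset.mem_filter, Finset.mem_univ, true_and, g, Fin.ext_iff]
      have := c.length_le
      have := j.2
      omega
    rw [hfil]
    refine Finset.sum_congr rfl fun c hc => ?_
    rw [(Finset.mem_filter.1 hc).2]
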